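/- arXiv:2409.20216 — 3 statements merged into one kernel-verified Lean document; each statement's English description precedes it below -/
import Mathlib

section
/- Let 0 < λ ≤ π/2 and let f₁(z) = z·exp(∫₀^z (e^{λt} − 1)/t dt). Then f₁ ∈ S*_{λe} and its pre-Schwarzian norm satisfies ||P_{f₁}|| = (1 − α²)(e^{λα} + λα − 1)/α, where α is the unique root in (0,1) of the equation 1 + r² − 2λr³ − e^{λr}(1 − λr + r² + λr³) = 0. In particular, the bound of the norm estimate for S*_{λe} is sharp. -/
open Metric Set

noncomputable section

/-- The open unit disk in the complex plane. -/
def unitDisk : Set ℂ := Metric.ball 0 1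

/-- A function is normalized if it is analytic on the unit disk with f(0)=0 and f'(0)=1. -/
def IsNormalized (f : ℂ → ℂ) : Prop :=
  AnalyticOnNhd ℂ f unitDisk ∧ f 0 = 0 ∧ deriv f 0 = 1

/-- Subordination: f ≺ g on the unit disk. -/
def Subord (f g : ℂ → ℂ) : Prop :=
  ∃ ω : ℂ → ℂ, AnalyticOnNhd ℂ ω unitDisk ∧ ω 0 = 0 ∧
    Set.MapsTo ω unitDisk unitDisk ∧ Set.EqOn f (g ∘ ω) unitDisk

/-- The quantity z f'(z)/f(z), extended by its analytic value 1 at z = 0. -/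
def sratio (f : ℂ → ℂ) (z : ℂ) : ℂ := if z = 0 then 1 else z * deriv f z / f z

/-- The Ma-Minda starlike class S*(φ). -/
def MemSstar (φ f : ℂ → ℂ) : Prop :=
  IsNormalized f ∧ (∀ z ∈ unitDisk, z ≠ 0 → f z ≠ 0) ∧ Subord (sratio f) φ

/-- The Ma-Minda convex class C(φ). -/
def MemC (φ g : ℂ → ℂ) : Prop :=
  IsNormalized g ∧ (∀ z ∈ unitDisk, deriv g z ≠ 0) ∧
    Subord (fun z => 1 + z * deriv (deriv g) z / deriv g z) φ

/-- The set of values (1-|z|²)|P_f(z)|, z ∈ 𝔻, whose supremum is the pre-Schwarzian norm. -/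
def pSVals (f : ℂ → ℂ) : Set ℝ :=
  {x : ℝ | ∃ z ∈ unitDisk, x = (1 - ‖z‖^2) * ‖deriv (deriv f) z / deriv f z‖}

/-- The integrand (e^{λt} − 1)/t, extended by its analytic value λ at t = 0. -/
def expIntegrand (lam : ℝ) (t : ℂ) : ℂ :=
  if t = 0 then (lam : ℂ) else (Complex.exp ((lam:ℂ) * t) - 1) / t

/-- The extremal function f₁(z) = z·exp(∫₀^z (e^{λt} − 1)/t dt), the integral being
taken along the segment from 0 to z. -/
def extremalSstarLambdaE (lam : ℝ) (z : ℂ) : ℂ :=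
  z * Complex.exp (z * ∫ s in (0:ℝ)..1, expIntegrand lam ((s:ℂ) * z))

theorem expIntegrand_eq_dslope (lam : ℝ) :
    expIntegrand lam = dslope (fun t : ℂ => Complex.exp (lam * t)) 0 := by
  funext t
  rcases eq_or_ne t 0 with rfl | ht
  · have h : HasDerivAt (fun t : ℂ => Complex.exp (lam * t)) lam 0 := by
      simpa using ((hasDerivAt_id (0 : ℂ)).const_mul (lam : ℂ)).cexp
    simp [expIntegrand, h.deriv]
  · simp [expIntegrand, ht, dslope_of_ne, slope_def_field]

theorem differentiable_expIntegrand (lam : ℝ) : Differentiable ℂ (expIntegrand lam) := by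
  rw [expIntegrand_eq_dslope, ← differentiableOn_univ,
    Complex.differentiableOn_dslope Filter.univ_mem]
  fun_prop

theorem mul_expIntegrand (lam : ℝ) (z : ℂ) :
    z * expIntegrand lam z = Complex.exp (lam * z) - 1 := by
  rcases eq_or_ne z 0 with rfl | hz
  · simp
  · simp [expIntegrand, hz, mul_div_cancel₀]

theorem hasDerivAt_mul_integral_expIntegrand (lam : ℝ) (z : ℂ) :
    HasDerivAt (fun z : ℂ => z * ∫ s in (0:ℝ)..1, expIntegrand lam ((s:ℂ) * z))
      (expIntegrand lam z) z := by
  obtain ⟨G, hG⟩ := (differentiable_expIntegrand lam).isExactOn_univ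
  have h (w : ℂ) : w * ∫ s in (0:ℝ)..1, expIntegrand lam ((s:ℂ) * w) = G w - G 0 := by
    have hd (s : ℝ) : HasDerivAt (fun s : ℝ => G ((s:ℂ) * w))
        (w * expIntegrand lam ((s:ℂ) * w)) s := by
      have h₁ : HasDerivAt (fun s : ℝ => (s:ℂ) * w) w s := by
        simpa using (hasDerivAt_id s).ofReal_comp.mul_const w
      exact ((hG ((s:ℂ) * w) (mem_univ _)).comp s h₁).congr_deriv (mul_comm _ _)
    have hc : Continuous fun s : ℝ => w * expIntegrand lam ((s:ℂ) * w) := by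
      have := (differentiable_expIntegrand lam).continuous
      fun_prop
    rw [← intervalIntegral.integral_const_mul,
      intervalIntegral.integral_eq_sub_of_hasDerivAt (fun s _ => hd s)
        (hc.intervalIntegrable 0 1)]
    simp
  simpa only [h] using (hG z (mem_univ _)).sub_const (G 0)

theorem hasDerivAt_extremalSstarLambdaE (lam : ℝ) (z : ℂ) :
    HasDerivAt (extremalSstarLambdaE lam)
      (Complex.exp (z * ∫ s in (0:ℝ)..1, expIntegrand lam ((s:ℂ) * z)) *
        Complex.exp (lam * z)) z := by
  have h := (hasDerivAt_id z).mul (hasDerivAt_mul_integral_expIntegrand lam z).cexp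
  refine h.congr_deriv ?_
  simp only [id]
  linear_combination Complex.exp (z * ∫ s in (0:ℝ)..1, expIntegrand lam ((s:ℂ) * z)) *
    mul_expIntegrand lam z

theorem preSchwarzian_extremalSstarLambdaE (lam : ℝ) (z : ℂ) :
    deriv (deriv (extremalSstarLambdaE lam)) z / deriv (extremalSstarLambdaE lam) z =
      expIntegrand lam z + lam := by
  rw [funext fun w => (hasDerivAt_extremalSstarLambdaE lam w).deriv]
  have h₁ : HasDerivAt (fun z : ℂ => Complex.exp (lam * z)) (Complex.exp (lam * z) * lam) z := by
    simpa using ((hasDerivAt_id z).const_mul (lam : ℂ)).cexp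
  have h := (hasDerivAt_mul_integral_expIntegrand lam z).cexp.mul h₁
  refine (congrArg (· / _) h.deriv).trans ?_
  rw [div_eq_iff (mul_ne_zero (Complex.exp_ne_zero _) (Complex.exp_ne_zero _))]
  ring

theorem memSstar_extremalSstarLambdaE (lam : ℝ) :
    MemSstar (fun z => Complex.exp ((lam:ℂ) * z)) (extremalSstarLambdaE lam) := by
  have hd : Differentiable ℂ (extremalSstarLambdaE lam) :=
    fun z => (hasDerivAt_extremalSstarLambdaE lam z).differentiableAt
  refine ⟨⟨hd.differentiableOn.analyticOnNhd isOpen_ball, by simp [extremalSstarLambdaE], ?_⟩,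
    fun z _ hz => mul_ne_zero hz (Complex.exp_ne_zero _),
    id, analyticOnNhd_id, rfl, mapsTo_id _, fun z _ => ?_⟩
  · rw [(hasDerivAt_extremalSstarLambdaE lam 0).deriv]
    simp
  · rcases eq_or_ne z 0 with rfl | hz
    · simp [sratio]
    · have := Complex.exp_ne_zero (z * ∫ s in (0:ℝ)..1, expIntegrand lam ((s:ℂ) * z))
      simp only [sratio, hz, if_false, Function.comp, id,
        (hasDerivAt_extremalSstarLambdaE lam z).deriv, extremalSstarLambdaE]
      field_simp

/-- The bound `(1 - r²)(e^{λr} + λr - 1)/r` for `(1 - |z|²)|P_{f₁}(z)|` on `|z| = r`. -/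
def radialBound (lam r : ℝ) : ℝ := (1 - r^2) * (Real.exp (lam*r) + lam*r - 1) / r

theorem hasDerivAt_exp_const_mul (lam r : ℝ) :
    HasDerivAt (fun r => Real.exp (lam*r)) (lam * Real.exp (lam*r)) r := by
  simpa [mul_comm] using ((hasDerivAt_id r).const_mul lam).exp

theorem hasDerivAt_radialBound (lam : ℝ) {r : ℝ} (hr : r ≠ 0) :
    HasDerivAt (radialBound lam)
      ((1 + r^2 - 2*lam*r^3 - Real.exp (lam*r) * (1 - lam*r + r^2 + lam*r^3)) / r^2) r := by
  have hid := hasDerivAt_id r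
  have h := (((hid.pow 2).const_sub 1).mul
    (((hasDerivAt_exp_const_mul lam r).add (hid.const_mul lam)).sub_const 1)).div hid hr
  refine h.congr_deriv ?_
  simp
  field_simp
  ring

theorem radialBound_second_deriv_numerator_nonpos {lam r : ℝ} (hlam : 0 < lam)
    (hlam' : lam^2 ≤ 6) (hr : 0 ≤ r) :
    -2 - 2*lam*r^3 + Real.exp (lam*r) * (2 - 2*lam*r + lam^2*r^2 - 2*lam*r^3 - lam^2*r^4) ≤ 0 := by
  let G : ℝ → ℝ := fun r => -2 - 2*lam*r^3 +
    Real.exp (lam*r) * (2 - 2*lam*r + lam^2*r^2 - 2*lam*r^3 - lam^2*r^4)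
  have hG (x : ℝ) : HasDerivAt G (-6*lam*x^2 +
      Real.exp (lam*x) * x^2 * lam * (lam^2 - 6 - 6*lam*x - lam^2*x^2)) x := by
    have hid := hasDerivAt_id x
    have h := (((hid.pow 3).const_mul (2*lam)).const_sub (-2)).add
      ((hasDerivAt_exp_const_mul lam x).mul
        ((((((hid.const_mul (2*lam)).const_sub 2).add ((hid.pow 2).const_mul (lam^2))).sub
          ((hid.pow 3).const_mul (2*lam)))).sub ((hid.pow 4).const_mul (lam^2))))
    refine h.congr_deriv ?_
    simp
    ring
  have hanti : AntitoneOn G (Ici 0) := by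
    refine antitoneOn_of_deriv_nonpos (convex_Ici 0)
      (fun x _ => (hG x).continuousAt.continuousWithinAt)
      (fun x _ => (hG x).differentiableAt.differentiableWithinAt) fun x hx => ?_
    rw [interior_Ici, mem_Ioi] at hx
    rw [(hG x).deriv]
    have h₁ : 0 ≤ Real.exp (lam*x) * x^2 * lam := by positivity
    have h₂ : lam^2 - 6 - 6*lam*x - lam^2*x^2 ≤ 0 := by
      have : 0 ≤ lam*x := by positivity
      nlinarith [sq_nonneg (lam*x)]
    nlinarith [mul_nonneg_of_nonpos_of_nonpos h₂ (neg_nonpos.2 h₁),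
      mul_nonneg hlam.le (sq_nonneg x)]
  have := hanti self_mem_Ici (mem_Ici.2 hr) hr
  simpa [G] using this

theorem antitoneOn_deriv_radialBound {lam : ℝ} (hlam : 0 < lam) (hlam' : lam^2 ≤ 6) :
    AntitoneOn (fun r => (1 + r^2 - 2*lam*r^3 -
      Real.exp (lam*r) * (1 - lam*r + r^2 + lam*r^3)) / r^2) (Ioi 0) := by
  have hd {x : ℝ} (hx : x ≠ 0) : HasDerivAt (fun r => (1 + r^2 - 2*lam*r^3 -
      Real.exp (lam*r) * (1 - lam*r + r^2 + lam*r^3)) / r^2)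
      ((-2 - 2*lam*x^3 + Real.exp (lam*x) *
        (2 - 2*lam*x + lam^2*x^2 - 2*lam*x^3 - lam^2*x^4)) / x^3) x := by
    have hid := hasDerivAt_id x
    have h := ((((hid.pow 2).const_add 1).sub ((hid.pow 3).const_mul (2*lam))).sub
      ((hasDerivAt_exp_const_mul lam x).mul
        ((((hid.const_mul lam).const_sub 1).add (hid.pow 2)).add
          ((hid.pow 3).const_mul lam)))).div (hid.pow 2) (pow_ne_zero 2 hx)
    refine h.congr_deriv ?_
    simp
    field_simp
    ring
  refine antitoneOn_of_deriv_nonpos (convex_Ioi 0)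
    (fun x hx => (hd (ne_of_gt hx)).continuousAt.continuousWithinAt)
    (fun x hx => (hd (ne_of_gt (interior_subset hx))).differentiableAt.differentiableWithinAt)
    fun x hx => ?_
  rw [interior_Ioi, mem_Ioi] at hx
  rw [(hd hx.ne').deriv]
  exact div_nonpos_of_nonpos_of_nonneg
    (radialBound_second_deriv_numerator_nonpos hlam hlam' hx.le) (by positivity)

theorem radialBound_le_of_root {lam α r : ℝ} (hlam : 0 < lam) (hlam' : lam^2 ≤ 6) (hα : 0 < α)
    (hroot : 1 + α^2 - 2*lam*α^3 - Real.exp (lam*α) * (1 - lam*α + α^2 + lam*α^3) = 0)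
    (hr : 0 < r) : radialBound lam r ≤ radialBound lam α := by
  have hanti := antitoneOn_deriv_radialBound hlam hlam'
  rcases le_total r α with h | h
  · have hmono : MonotoneOn (radialBound lam) (Ioc 0 α) := by
      refine monotoneOn_of_deriv_nonneg (convex_Ioc 0 α)
        (fun x hx => (hasDerivAt_radialBound lam hx.1.ne').continuousAt.continuousWithinAt)
        (fun x hx => (hasDerivAt_radialBound lam
          (interior_subset hx).1.ne').differentiableAt.differentiableWithinAt) fun x hx => ?_
      have hx' := interior_subset hx
      rw [(hasDerivAt_radialBound lam hx'.1.ne').deriv]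
      simpa [hroot] using hanti hx'.1 hα hx'.2
    exact hmono ⟨hr, h⟩ ⟨hα, le_rfl⟩ h
  · have hmono : AntitoneOn (radialBound lam) (Ici α) := by
      have hpos {x : ℝ} (hx : x ∈ Ici α) : 0 < x := hα.trans_le hx
      refine antitoneOn_of_deriv_nonpos (convex_Ici α)
        (fun x hx => (hasDerivAt_radialBound lam (hpos hx).ne').continuousAt.continuousWithinAt)
        (fun x hx => (hasDerivAt_radialBound lam
          (hpos (interior_subset hx)).ne').differentiableAt.differentiableWithinAt) fun x hx => ?_
      have hx' := interior_subset hx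
      rw [(hasDerivAt_radialBound lam (hpos hx').ne').deriv]
      simpa [hroot] using hanti hα (hpos hx') hx'
    exact hmono self_mem_Ici h h

theorem two_mul_le_radialBound {lam : ℝ} (hlam : 0 < lam) (hlam' : lam ≤ 4) :
    2 * lam ≤ radialBound lam (lam/8) := by
  have hr : 0 < lam/8 := by positivity
  rw [radialBound, le_div_iff₀ hr]
  have hexp := Real.quadratic_le_exp_of_nonneg (x := lam*(lam/8)) (by positivity)
  have h₁ : 0 ≤ 1 - (lam/8)^2 := by nlinarith
  refine le_trans ?_ (mul_le_mul_of_nonneg_left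
    (show 2*(lam*(lam/8)) + (lam*(lam/8))^2/2 ≤ _ by linarith) h₁)
  nlinarith [mul_nonneg (pow_nonneg hlam.le 4) (show 0 ≤ 32 - lam^2 by nlinarith)]

theorem norm_exp_sub_one_le_exp_norm_sub_one (z : ℂ) :
    ‖Complex.exp z - 1‖ ≤ Real.exp ‖z‖ - 1 := by
  simpa using Complex.norm_exp_sub_sum_le_exp_norm_sub_sum z 1

theorem norm_preSchwarzian_le_radialBound {lam : ℝ} (hlam : 0 < lam) {z : ℂ} (hz : z ≠ 0)
    (hz' : ‖z‖ ≤ 1) :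
    (1 - ‖z‖^2) * ‖expIntegrand lam z + lam‖ ≤ radialBound lam ‖z‖ := by
  have hr : 0 < ‖z‖ := norm_pos_iff.2 hz
  rw [radialBound, mul_div_assoc]
  refine mul_le_mul_of_nonneg_left ?_ (by nlinarith)
  have h := norm_exp_sub_one_le_exp_norm_sub_one (lam * z)
  rw [norm_mul, Complex.norm_of_nonneg hlam.le] at h
  calc ‖expIntegrand lam z + lam‖ ≤ ‖expIntegrand lam z‖ + ‖(lam : ℂ)‖ := norm_add_le _ _
    _ ≤ (Real.exp (lam * ‖z‖) - 1) / ‖z‖ + lam := by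
      rw [Complex.norm_of_nonneg hlam.le, expIntegrand, if_neg hz, norm_div]
      gcongr
    _ = _ := by field_simp; ring

/-- Sharpness of the pre-Schwarzian norm estimate for S*_{λe}: the extremal function f₁
belongs to S*_{λe} and its pre-Schwarzian norm equals the bound. -/
theorem preSchwarzian_sharp_Sstar_lambda_e (lam : ℝ) (hlam₀ : 0 < lam)
    (hlam₁ : lam ≤ Real.pi / 2)
    (α : ℝ) (hα : α ∈ Set.Ioo (0:ℝ) 1)
    (hroot : 1 + α^2 - 2*lam*α^3 - Real.exp (lam*α) * (1 - lam*α + α^2 + lam*α^3) = 0) :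
    MemSstar (fun z => Complex.exp ((lam:ℂ) * z)) (extremalSstarLambdaE lam) ∧
      IsLUB (pSVals (extremalSstarLambdaE lam))
        ((1 - α^2) * (Real.exp (lam*α) + lam*α - 1) / α) := by
  obtain ⟨hα₀, hα₁⟩ := hα
  have hlam₂ : lam ≤ 2 := by linarith [Real.pi_le_four]
  have hlam₃ : lam^2 ≤ 6 := by nlinarith
  refine ⟨memSstar_extremalSstarLambdaE lam, IsGreatest.isLUB ⟨⟨α, ?_, ?_⟩, ?_⟩⟩
  · simpa [unitDisk, abs_of_pos hα₀] using hα₁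
  · have h : expIntegrand lam α + lam = (((Real.exp (lam*α) + lam*α - 1) / α : ℝ) : ℂ) := by
      have : (α : ℂ) ≠ 0 := by exact_mod_cast hα₀.ne'
      rw [expIntegrand, if_neg this]
      push_cast
      field_simp
      ring
    have hpos : 0 ≤ (Real.exp (lam*α) + lam*α - 1) / α := by
      have := mul_pos hlam₀ hα₀
      exact div_nonneg (by linarith [Real.add_one_le_exp (lam*α)]) hα₀.le
    rw [preSchwarzian_extremalSstarLambdaE, h, Complex.norm_of_nonneg hpos,
      Complex.norm_of_nonneg hα₀.le, mul_div_assoc]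
  · rintro x ⟨z, hz, rfl⟩
    rw [preSchwarzian_extremalSstarLambdaE]
    rcases eq_or_ne z 0 with rfl | hz₀
    · have h := (two_mul_le_radialBound hlam₀ (by linarith)).trans
        (radialBound_le_of_root hlam₀ hlam₃ hα₀ hroot (by positivity))
      refine le_trans (le_of_eq ?_) h
      rw [expIntegrand, if_pos rfl, ← two_mul, norm_mul, Complex.norm_of_nonneg hlam₀.le]
      simp
    · exact (norm_preSchwarzian_le_radialBound hlam₀ hz₀ (mem_ball_zero_iff.1 hz).le).trans
        (radialBound_le_of_root hlam₀ hlam₃ hα₀ hroot (norm_pos_iff.2 hz₀))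
end
end

section
/- Let 0 < c ≤ 1 and let f ∈ S*(q_c). Then the pre-Schwarzian norm of f satisfies ||P_f|| ≤ c(1 − α²)/(2(1 − cα)) + (1 − α²)(1 − √(1 − cα))/α, where α is the unique root in (0,1) of the equation −2 + 4cr − (2 + c²)r² + 2cr³ − c²r⁴ + (1 − cr)^{3/2}(2 − cr + 2r² − 3cr³) = 0. -/
open Metric Set

noncomputable section

open scoped ComplexConjugate Topology

lemma norm_sub_lt_norm_one_sub_conj_mul {b w : ℂ} (hb : ‖b‖ < 1) (hw : ‖w‖ < 1) :
    ‖w - b‖ < ‖1 - conj b * w‖ := by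
  have key : ‖1 - conj b * w‖ ^ 2 - ‖w - b‖ ^ 2 = (1 - ‖w‖ ^ 2) * (1 - ‖b‖ ^ 2) := by
    simp only [← Complex.normSq_eq_norm_sq, Complex.normSq_apply, Complex.sub_re, Complex.sub_im,
      Complex.mul_re, Complex.mul_im, Complex.conj_re, Complex.conj_im, Complex.one_re,
      Complex.one_im]
    ring
  have h1 : 0 < 1 - ‖w‖ ^ 2 := by nlinarith [norm_nonneg w]
  have h2 : 0 < 1 - ‖b‖ ^ 2 := by nlinarith [norm_nonneg b]
  nlinarith [mul_pos h1 h2, norm_nonneg (w - b), norm_nonneg (1 - conj b * w)]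

/-- The disk automorphism `w ↦ (w - b) / (1 - conj b * w)` maps the disk into itself. -/
lemma norm_div_one_sub_conj_mul_lt_one {b w : ℂ} (hb : ‖b‖ < 1) (hw : ‖w‖ < 1) :
    ‖(w - b) / (1 - conj b * w)‖ < 1 := by
  have h := norm_sub_lt_norm_one_sub_conj_mul hb hw
  rw [norm_div, div_lt_one ((norm_nonneg _).trans_lt h)]
  exact h

lemma one_sub_conj_mul_ne_zero {b w : ℂ} (hb : ‖b‖ < 1) (hw : ‖w‖ < 1) :
    1 - conj b * w ≠ 0 :=
  norm_pos_iff.1 ((norm_nonneg _).trans_lt (norm_sub_lt_norm_one_sub_conj_mul hb hw))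

lemma hasDerivAt_div_one_sub_conj_mul {b w : ℂ} (hb : ‖b‖ < 1) (hw : ‖w‖ < 1) :
    HasDerivAt (fun u : ℂ => (u - b) / (1 - conj b * u))
      ((1 - conj b * b) / (1 - conj b * w) ^ 2) w := by
  have h := ((hasDerivAt_id w).sub_const b).div
    (((hasDerivAt_id w).const_mul (conj b)).const_sub 1) (one_sub_conj_mul_ne_zero hb hw)
  refine h.congr_deriv ?_
  simp only [id]
  ring

/-- The **Schwarz–Pick lemma** for the derivative of a holomorphic self-map of the unit disk. -/
theorem schwarzPick_deriv {ω : ℂ → ℂ} (hd : DifferentiableOn ℂ ω (ball 0 1))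
    (hm : MapsTo ω (ball 0 1) (ball 0 1)) {a : ℂ} (ha : ‖a‖ < 1) :
    (1 - ‖a‖ ^ 2) * ‖deriv ω a‖ ≤ 1 - ‖ω a‖ ^ 2 := by
  have hb : ‖ω a‖ < 1 := by simpa using hm (mem_ball_zero_iff.2 ha)
  set b := ω a with hbdef
  have ha' : ‖-a‖ < 1 := by simpa using ha
  let m : ℂ → ℂ := fun u => (u - (-a)) / (1 - conj (-a) * u)
  let M : ℂ → ℂ := fun u => (u - b) / (1 - conj b * u)
  have hmm : ∀ u : ℂ, ‖u‖ < 1 → ‖m u‖ < 1 := fun u hu => norm_div_one_sub_conj_mul_lt_one ha' hu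
  have hmd : ∀ u : ℂ, ‖u‖ < 1 → HasDerivAt m _ u := fun u hu =>
    hasDerivAt_div_one_sub_conj_mul ha' hu
  have hωm : ∀ u : ℂ, ‖u‖ < 1 → ‖ω (m u)‖ < 1 := fun u hu => by
    simpa using hm (mem_ball_zero_iff.2 (hmm u hu))
  have hωd : ∀ u : ℂ, ‖u‖ < 1 → HasDerivAt ω (deriv ω u) u := fun u hu =>
    (hd.differentiableAt (isOpen_ball.mem_nhds (mem_ball_zero_iff.2 hu))).hasDerivAt
  have hm0 : m 0 = a := by simp [m]
  have hM : M (ω (m 0)) = 0 := by simp [M, hm0, hbdef]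
  have hcomp : ∀ u : ℂ, ‖u‖ < 1 → HasDerivAt (fun v => M (ω (m v)))
      ((1 - conj b * b) / (1 - conj b * ω (m u)) ^ 2 * (deriv ω (m u) *
        ((1 - conj (-a) * (-a)) / (1 - conj (-a) * u) ^ 2))) u := fun u hu =>
    HasDerivAt.comp (h₂ := M) (h := fun v => ω (m v)) u
      (hasDerivAt_div_one_sub_conj_mul hb (hωm u hu))
      (HasDerivAt.comp (h₂ := ω) (h := m) u (hωd _ (hmm u hu)) (hmd u hu))
  have h1 : ‖deriv (fun v => M (ω (m v))) 0‖ ≤ 1 := by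
    refine Complex.norm_deriv_le_one_of_mapsTo_ball (R := 1) ?_ ?_ one_pos
    · intro u hu
      exact (hcomp u (mem_ball_zero_iff.1 hu)).differentiableAt.differentiableWithinAt
    · intro u hu
      rw [hM, mem_closedBall_zero_iff]
      exact (norm_div_one_sub_conj_mul_lt_one hb (hωm u (mem_ball_zero_iff.1 hu))).le
  rw [(hcomp 0 (by simp)).deriv, hm0, ← hbdef] at h1
  have hA : (1 : ℂ) - conj (-a) * (-a) = ((1 - ‖a‖ ^ 2 : ℝ) : ℂ) := by
    rw [Complex.conj_mul', norm_neg]; push_cast; ring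
  have hB : (1 : ℂ) - conj b * b = ((1 - ‖b‖ ^ 2 : ℝ) : ℂ) := by
    rw [Complex.conj_mul']; push_cast; ring
  have h2 : 0 < 1 - ‖b‖ ^ 2 := by nlinarith [norm_nonneg b]
  have h3 : 0 < 1 - ‖a‖ ^ 2 := by nlinarith [norm_nonneg a]
  rw [hA, hB] at h1
  simp only [mul_zero, sub_zero, one_pow, div_one, norm_mul, norm_div, norm_pow, Complex.norm_real,
    Real.norm_eq_abs, abs_of_pos h2, abs_of_pos h3] at h1
  have h4 : (1 - ‖b‖ ^ 2) / (1 - ‖b‖ ^ 2) ^ 2 * (‖deriv ω a‖ * (1 - ‖a‖ ^ 2))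
      = (‖deriv ω a‖ * (1 - ‖a‖ ^ 2)) / (1 - ‖b‖ ^ 2) := by
    field_simp
  rw [h4, div_le_one h2] at h1
  linarith

/-- Distance from `1` of a square root of `1 + w`, in the right half-plane, for `‖w‖ ≤ t < 1`. -/
lemma norm_sub_one_le_of_sq_eq {S w : ℂ} {t : ℝ} (hS : S ^ 2 = 1 + w) (hre : 0 < S.re)
    (hw : ‖w‖ ≤ t) (ht : t < 1) : ‖S - 1‖ ≤ 1 - √(1 - t) := by
  have hprod : ‖S - 1‖ * ‖S + 1‖ = ‖w‖ := by
    rw [← norm_mul]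
    congr 1
    linear_combination hS
  have hlt : ‖S - 1‖ < ‖S + 1‖ := by
    have : ‖S + 1‖ ^ 2 - ‖S - 1‖ ^ 2 = 4 * S.re := by
      simp only [← Complex.normSq_eq_norm_sq, Complex.normSq_apply, Complex.sub_re, Complex.sub_im,
        Complex.add_re, Complex.add_im, Complex.one_re, Complex.one_im]
      ring
    nlinarith [norm_nonneg (S - 1), norm_nonneg (S + 1)]
  have htri : 2 ≤ ‖S + 1‖ + ‖S - 1‖ := by
    have := norm_sub_le (S + 1) (S - 1)
    have h2 : (S + 1) - (S - 1) = 2 := by ring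
    rw [h2] at this
    simpa using this
  have hd := norm_nonneg (S - 1)
  have hd1 : ‖S - 1‖ < 1 := by nlinarith
  have hle : ‖S - 1‖ * (2 - ‖S - 1‖) ≤ t := by nlinarith
  have : √(1 - t) ≤ 1 - ‖S - 1‖ := by
    rw [Real.sqrt_le_left (by linarith)]
    nlinarith
  linarith

/-- The majorant of the pre-Schwarzian norm, in the variable `u = √(1 - c * s)`, is maximal at its
critical point `v`. -/
lemma majorant_le_of_critical {c u v : ℝ} (hc₀ : 0 < c) (hc₁ : c ≤ 1) (hu : 0 < u) (hv : 0 < v)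
    (hv1 : v < 1) (s α : ℝ) (hs : c * s = 1 - u ^ 2) (hα : c * α = 1 - v ^ 2)
    (hroot : -2 + 4 * c * α - (2 + c ^ 2) * α ^ 2 + 2 * c * α ^ 3 - c ^ 2 * α ^ 4 +
      v ^ 3 * (2 - c * α + 2 * α ^ 2 - 3 * c * α ^ 3) = 0) :
    c * (1 - s ^ 2) / (2 * u ^ 2) + c * (1 - s ^ 2) / (1 + u) ≤
      c * (1 - α ^ 2) / (2 * v ^ 2) + c * (1 - α ^ 2) / (1 + v) := by
  obtain rfl : s = (1 - u ^ 2) / c := by field_simp; linarith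
  obtain rfl : α = (1 - v ^ 2) / c := by field_simp; linarith
  have hv2 : 1 - v ^ 2 ≠ 0 := by nlinarith
  have key : c * (c * (1 - ((1 - u ^ 2) / c) ^ 2) / (2 * u ^ 2) +
        c * (1 - ((1 - u ^ 2) / c) ^ 2) / (1 + u) - (c * (1 - ((1 - v ^ 2) / c) ^ 2) / (2 * v ^ 2) +
        c * (1 - ((1 - v ^ 2) / c) ^ 2) / (1 + v))) =
      -((1 - c ^ 2) * (u ^ 2 - v ^ 2) ^ 2 / (2 * u ^ 2 * v ^ 4)) -
      (u - v) ^ 2 / (2 * v) * (1 + v * (2 * u + v) -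
        c ^ 2 * ((1 + u + 2 * v) / ((1 + v) ^ 2 * (1 + u)))) +
      (-2 + 4 * c * ((1 - v ^ 2) / c) - (2 + c ^ 2) * ((1 - v ^ 2) / c) ^ 2 +
        2 * c * ((1 - v ^ 2) / c) ^ 3 - c ^ 2 * ((1 - v ^ 2) / c) ^ 4 +
        v ^ 3 * (2 - c * ((1 - v ^ 2) / c) + 2 * ((1 - v ^ 2) / c) ^ 2 -
          3 * c * ((1 - v ^ 2) / c) ^ 3)) *
        ((v ^ 2 - u ^ 2) / (2 * ((1 - v ^ 2) / c) ^ 2 * v ^ 4)) := by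
    field_simp
    ring
  rw [hroot, zero_mul, add_zero] at key
  have hc2 : 0 ≤ 1 - c ^ 2 := by nlinarith
  have hT1 : 0 ≤ (1 - c ^ 2) * (u ^ 2 - v ^ 2) ^ 2 / (2 * u ^ 2 * v ^ 4) := by positivity
  have hq : (1 + u + 2 * v) / ((1 + v) ^ 2 * (1 + u)) ≤ 1 := by
    rw [div_le_one (by positivity)]
    nlinarith [mul_pos hu hv, mul_pos hu (pow_pos hv 2), pow_pos hv 2]
  have hq0 : 0 ≤ (1 + u + 2 * v) / ((1 + v) ^ 2 * (1 + u)) := by positivity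
  have hT2 : 0 ≤ (u - v) ^ 2 / (2 * v) * (1 + v * (2 * u + v) -
      c ^ 2 * ((1 + u + 2 * v) / ((1 + v) ^ 2 * (1 + u)))) := by
    refine mul_nonneg (by positivity) ?_
    have : 0 ≤ v * (2 * u + v) := by positivity
    nlinarith
  exact sub_nonpos.1 (nonpos_of_mul_nonpos_right (key.trans_le (by linarith)) hc₀)

/-- The pre-Schwarzian derivative in terms of a square root of `1 + c ω` lifting `z f' / f`. -/
lemma preSchwarzian_eq {f S : ℂ → ℂ} {z p q : ℂ} {c : ℂ} (hz : z ≠ 0) (hfz : f z ≠ 0)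
    (hf : DifferentiableAt ℂ f z) (hf' : DifferentiableAt ℂ (deriv f) z)
    (heq : (fun w => w * deriv f w) =ᶠ[𝓝 z] fun w => S w * f w)
    (hS : HasDerivAt S (c * q / (2 * S z)) z) (hp : S z ^ 2 = 1 + c * p) (hSz : S z ≠ 0) :
    deriv (deriv f) z / deriv f z = (S z - 1) / z + c * q / (2 * (1 + c * p)) := by
  have h0 : z * deriv f z = S z * f z := heq.eq_of_nhds
  have hne : deriv f z ≠ 0 := by
    intro h
    rw [h, mul_zero] at h0
    exact mul_ne_zero hSz hfz h0.symm
  have h1 := ((hasDerivAt_id z).mul hf'.hasDerivAt).unique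
    ((hS.mul hf.hasDerivAt).congr_of_eventuallyEq heq)
  simp only [id, one_mul] at h1
  have hfe : f z = z * deriv f z / S z := by rw [h0]; field_simp
  rw [hfe] at h1
  rw [← hp]
  field_simp
  field_simp at h1
  linear_combination h1

/-- The majorant for the pre-Schwarzian norm at a point with `‖z‖ = r`, `‖ω z‖ = s ≤ r`. -/
lemma majorant_of_le {c r s d e : ℝ} (hc₀ : 0 < c) (hc₁ : c ≤ 1) (hs : 0 ≤ s) (hsr : s ≤ r)
    (hr₀ : 0 < r) (hr : r < 1) (hd : d ≤ 1 - √(1 - c * s)) (he : (1 - r ^ 2) * e ≤ 1 - s ^ 2) :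
    (1 - r ^ 2) * (d / r + c * e / (2 * (1 - c * s))) ≤
      c * (1 - s ^ 2) / (2 * √(1 - c * s) ^ 2) + c * (1 - s ^ 2) / (1 + √(1 - c * s)) := by
  have hcs : 0 < 1 - c * s := by nlinarith
  have hu := Real.sqrt_pos.2 hcs
  have hsq := Real.sq_sqrt hcs.le
  set u := √(1 - c * s)
  rw [hsq, add_comm (c * (1 - s ^ 2) / _), mul_add]
  refine add_le_add ?_ ?_
  · have h1 : 1 - u = c * s / (1 + u) := by
      field_simp
      linarith
    have h2 : (1 - r ^ 2) * s ≤ (1 - s ^ 2) * r := by nlinarith [mul_nonneg hs hr₀.le]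
    have hr2 : 0 ≤ 1 - r ^ 2 := by nlinarith
    calc (1 - r ^ 2) * (d / r) ≤ (1 - r ^ 2) * ((c * s / (1 + u)) / r) := by
          rw [← h1]
          gcongr
      _ = c * (((1 - r ^ 2) * s) / r) / (1 + u) := by field_simp
      _ ≤ c * (1 - s ^ 2) / (1 + u) := by
          gcongr
          rwa [div_le_iff₀ hr₀]
  · calc (1 - r ^ 2) * (c * e / (2 * (1 - c * s))) = c * ((1 - r ^ 2) * e) / (2 * (1 - c * s)) := by
          ring
      _ ≤ _ := by gcongr

lemma one_add_mul_re_pos {c : ℝ} {w : ℂ} (hc₀ : 0 < c) (hc₁ : c ≤ 1) (hw : ‖w‖ < 1) :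
    0 < (1 + (c : ℂ) * w).re := by
  have h := neg_le_of_abs_le (Complex.abs_re_le_norm w)
  simp only [Complex.add_re, Complex.one_re, Complex.re_ofReal_mul]
  nlinarith [norm_nonneg w]

lemma cpow_half_re_pos {w : ℂ} (hw : 0 < w.re) : 0 < (w ^ ((1 : ℂ) / 2)).re := by
  have hw0 : w ≠ 0 := by
    rintro rfl
    simp at hw
  have harg := abs_lt.1 (Complex.abs_arg_lt_pi_div_two_iff.2 (Or.inl hw))
  rw [Complex.cpow_def_of_ne_zero hw0, Complex.exp_re]
  refine mul_pos (Real.exp_pos _) (Real.cos_pos_of_mem_Ioo ?_)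
  have him : (Complex.log w * (1 / 2)).im = w.arg / 2 := by
    have : (1 / 2 : ℂ) = ((1 / 2 : ℝ) : ℂ) := by push_cast; rfl
    rw [this, Complex.im_mul_ofReal, Complex.log_im]
    ring
  rw [him]
  constructor <;> linarith [harg.1, harg.2, Real.pi_pos]

lemma cpow_half_sq (w : ℂ) : (w ^ ((1 : ℂ) / 2)) ^ 2 = w := by
  rw [one_div]
  exact_mod_cast Complex.cpow_nat_inv_pow w two_ne_zero

lemma hasDerivAt_cpow_half_comp {ω : ℂ → ℂ} {z c : ℂ} (hω : DifferentiableAt ℂ ω z)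
    (hre : 0 < (1 + c * ω z).re) :
    HasDerivAt (fun w => (1 + c * ω w) ^ ((1 : ℂ) / 2))
      (c * deriv ω z / (2 * (1 + c * ω z) ^ ((1 : ℂ) / 2))) z := by
  have h := ((hω.hasDerivAt.const_mul c).const_add 1).cpow_const (c := (1 : ℂ) / 2)
    (Or.inl hre)
  refine h.congr_deriv ?_
  have h0 : 1 + c * ω z ≠ 0 := by
    intro h0
    rw [h0] at hre
    simp at hre
  have h1 : (1 + c * ω z) ^ ((1 : ℂ) / 2) ≠ 0 := by
    rw [Complex.cpow_ne_zero_iff]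
    exact Or.inl h0
  rw [Complex.cpow_sub _ _ h0, Complex.cpow_one]
  have h2 := cpow_half_sq (1 + c * ω z)
  set S := (1 + c * ω z) ^ ((1 : ℂ) / 2)
  rw [← h2]
  field_simp

/-- Pre-Schwarzian norm estimate for the class S*(q_c). -/
theorem preSchwarzian_bound_Sstar_qc (c : ℝ) (hc₀ : 0 < c) (hc₁ : c ≤ 1)
    (f : ℂ → ℂ) (hf : MemSstar (fun z => (1 + (c:ℂ) * z) ^ ((1:ℂ)/2)) f)
    (α : ℝ) (hα : α ∈ Set.Ioo (0:ℝ) 1)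
    (hroot : -2 + 4*c*α - (2 + c^2)*α^2 + 2*c*α^3 - c^2*α^4 +
      (1 - c*α) ^ ((3:ℝ)/2) * (2 - c*α + 2*α^2 - 3*c*α^3) = 0) :
    ∀ z ∈ unitDisk, (1 - ‖z‖^2) * ‖deriv (deriv f) z / deriv f z‖ ≤
      c * (1 - α^2) / (2 * (1 - c*α)) + (1 - α^2) * (1 - Real.sqrt (1 - c*α)) / α := by
  obtain ⟨⟨hfa, hf0, hf1⟩, hfne, ω, hωa, hω0, hωm, hω⟩ := hf
  obtain ⟨hα0, hα1⟩ := hα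
  have hopen : IsOpen unitDisk := isOpen_ball
  have hcα : 0 < 1 - c * α := by nlinarith
  have hcα0 : 0 < c * α := mul_pos hc₀ hα0
  have hv := Real.sqrt_pos.2 hcα
  have hvsq := Real.sq_sqrt hcα.le
  have hv1 : √(1 - c * α) < 1 := by
    rw [Real.sqrt_lt' one_pos]
    linarith
  have hpow : (1 - c * α) ^ ((3 : ℝ) / 2) = √(1 - c * α) ^ 3 := by
    rw [Real.sqrt_eq_rpow, ← Real.rpow_natCast, ← Real.rpow_mul hcα.le]
    norm_num
  rw [hpow] at hroot
  have hbound : c * (1 - α^2) / (2 * (1 - c*α)) + (1 - α^2) * (1 - √(1 - c*α)) / α =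
      c * (1 - α ^ 2) / (2 * √(1 - c * α) ^ 2) + c * (1 - α ^ 2) / (1 + √(1 - c * α)) := by
    rw [hvsq]
    congr 1
    generalize √(1 - c * α) = v at hvsq hv ⊢
    field_simp
    linear_combination -(1 - α ^ 2) * hvsq
  set B := c * (1 - α^2) / (2 * (1 - c*α)) + (1 - α^2) * (1 - √(1 - c*α)) / α
  have hωlt : ∀ w ∈ unitDisk, ‖ω w‖ < 1 := fun w hw => mem_ball_zero_iff.1 (hωm hw)
  have hS : ∀ w ∈ unitDisk, w * deriv f w = (1 + c * ω w) ^ ((1 : ℂ) / 2) * f w := by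
    intro w hw
    rcases eq_or_ne w 0 with rfl | hw0
    · simp [hf0]
    · have h := hω hw
      simp only [sratio, if_neg hw0, Function.comp_apply] at h
      rw [← h, div_mul_cancel₀ _ (hfne w hw hw0)]
  have hpunct : ∀ z ∈ unitDisk, z ≠ 0 → (1 - ‖z‖^2) * ‖deriv (deriv f) z / deriv f z‖ ≤ B := by
    intro z hz hz0
    have hz1 : ‖z‖ < 1 := mem_ball_zero_iff.1 hz
    have hr₀ : 0 < ‖z‖ := norm_pos_iff.2 hz0
    have hre := one_add_mul_re_pos hc₀ hc₁ (hωlt z hz)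
    have hSre := cpow_half_re_pos hre
    have hSne : (1 + c * ω z) ^ ((1 : ℂ) / 2) ≠ 0 := by
      intro h
      rw [h] at hSre
      simp at hSre
    have hsr : ‖ω z‖ ≤ ‖z‖ := Complex.norm_le_norm_of_mapsTo_ball hωa.differentiableOn
      (fun w hw => ball_subset_closedBall (hωm hw)) hω0 hz1
    have hcs : c * ‖ω z‖ < 1 := by nlinarith [norm_nonneg (ω z)]
    have hnorm : ‖(c : ℂ) * ω z‖ = c * ‖ω z‖ := by
      rw [norm_mul, Complex.norm_real, Real.norm_of_nonneg hc₀.le]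
    rw [preSchwarzian_eq hz0 (hfne z hz hz0) (hfa z hz).differentiableAt
      (hfa z hz).deriv.differentiableAt (Filter.eventually_of_mem (hopen.mem_nhds hz) hS)
      (hasDerivAt_cpow_half_comp (hωa z hz).differentiableAt hre) (cpow_half_sq _) hSne]
    have hden : 1 - c * ‖ω z‖ ≤ ‖1 + (c : ℂ) * ω z‖ := by
      have := norm_sub_le_norm_add (1 : ℂ) (c * ω z)
      rwa [norm_one, hnorm] at this
    have hd := norm_sub_one_le_of_sq_eq (cpow_half_sq (1 + c * ω z)) hSre hnorm.le hcs
    have he := schwarzPick_deriv hωa.differentiableOn hωm hz1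
    have hcs' : 0 < 1 - c * ‖ω z‖ := by linarith
    have hr2 : 0 ≤ 1 - ‖z‖ ^ 2 := by nlinarith
    have hu := Real.sqrt_pos.2 hcs'
    calc _ ≤ (1 - ‖z‖ ^ 2) * (‖(1 + c * ω z) ^ ((1 : ℂ) / 2) - 1‖ / ‖z‖ +
          c * ‖deriv ω z‖ / (2 * (1 - c * ‖ω z‖))) := by
          gcongr
          refine (norm_add_le _ _).trans ?_
          rw [norm_div, norm_div, norm_mul, norm_mul, Complex.norm_real,
            Real.norm_of_nonneg hc₀.le, Complex.norm_ofNat]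
          gcongr
      _ ≤ _ := majorant_of_le hc₀ hc₁ (norm_nonneg _) hsr hr₀ hz1 hd he
      _ ≤ _ := majorant_le_of_critical hc₀ hc₁ hu hv hv1 _ α
          (by rw [Real.sq_sqrt hcs'.le]; ring) (by rw [hvsq]; ring) hroot
      _ = B := hbound.symm
  intro z hz
  rcases eq_or_ne z 0 with rfl | hz0
  · have hcont : ContinuousAt
        (fun z : ℂ => (1 - ‖z‖^2) * ‖deriv (deriv f) z / deriv f z‖) 0 := by
      have h2 := (hfa 0 hz).deriv.deriv.continuousAt
      have h1 := (hfa 0 hz).deriv.continuousAt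
      have hne : deriv f 0 ≠ 0 := by simp [hf1]
      exact (by fun_prop : ContinuousAt (fun z : ℂ => 1 - ‖z‖^2) 0).mul (h2.div h1 hne).norm
    refine le_of_tendsto (hcont.tendsto.mono_left nhdsWithin_le_nhds) (x := 𝓝[≠] (0 : ℂ)) ?_
    filter_upwards [self_mem_nhdsWithin, mem_nhdsWithin_of_mem_nhds (hopen.mem_nhds hz)] with w hw hw'
    exact hpunct w hw' hw
  · exact hpunct z hz hz0
end
end

section
/- Let 0 < λ ≤ π/2. Then the function r ↦ λr e^{λr}(1 − r²) − (1 + r²)(e^{λr} − 1) has exactly one root in the open interval (0,1). -/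
open Set in
/-- A function vanishing at `0` with positive derivative on `(0, ∞)` is positive there. -/
theorem pos_of_hasDerivAt_pos {f f' : ℝ → ℝ} (hf : ∀ x, HasDerivAt f (f' x) x) (h0 : f 0 = 0)
    (hf' : ∀ x, 0 < x → 0 < f' x) {x : ℝ} (hx : 0 < x) : 0 < f x := by
  have hmono : StrictMonoOn f (Ici 0) := by
    refine strictMonoOn_of_deriv_pos (convex_Ici 0)
      (fun y _ => (hf y).continuousAt.continuousWithinAt) fun y hy => ?_
    rw [interior_Ici] at hy
    rw [(hf y).deriv]
    exact hf' y hy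
  simpa [h0] using hmono self_mem_Ici (mem_Ici.2 hx.le) hx

theorem sq_half_lt_mul_exp_sub_exp_add_one {t : ℝ} (ht : 0 < t) :
    t ^ 2 / 2 < t * Real.exp t - Real.exp t + 1 := by
  have h := pos_of_hasDerivAt_pos
    (f := fun t => t * Real.exp t - Real.exp t + 1 - t ^ 2 / 2)
    (f' := fun t => t * (Real.exp t - 1))
    (fun x => by
      have h := ((((hasDerivAt_id' x).mul (Real.hasDerivAt_exp x)).sub
        (Real.hasDerivAt_exp x)).add_const 1).sub (((hasDerivAt_id' x).pow 2).div_const 2)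
      refine h.congr_deriv ?_
      norm_num
      ring)
    (by simp)
    (fun x hx => mul_pos hx (by linarith [Real.add_one_lt_exp hx.ne'])) ht
  linarith

theorem two_mul_exp_sub_one_sq_lt {t : ℝ} (ht : 0 < t) :
    2 * (Real.exp t - 1) ^ 2 < t * Real.exp t * (Real.exp t - 1) + t ^ 2 * Real.exp t := by
  have hneg (x : ℝ) : HasDerivAt (fun x => Real.exp (-x)) (-Real.exp (-x)) x :=
    (hasDerivAt_neg x).exp.congr_deriv (by ring)
  have hderiv {x : ℝ} (hx : 0 < x) :
      0 < (x - 1) * Real.exp x - 1 + 2 * x + 2 * Real.exp (-x) := by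
    refine pos_of_hasDerivAt_pos
      (f := fun x => (x - 1) * Real.exp x - 1 + 2 * x + 2 * Real.exp (-x))
      (f' := fun x => x * Real.exp x + 2 * (1 - Real.exp (-x)))
      (fun x => ?_) (by norm_num) (fun x hx => ?_) hx
    · have h := ((((((hasDerivAt_id' x).sub_const 1).mul (Real.hasDerivAt_exp x)).sub_const
        1).add ((hasDerivAt_id' x).const_mul 2)).add ((hneg x).const_mul 2))
      exact h.congr_deriv (by ring)
    · have : Real.exp (-x) < 1 := Real.exp_lt_one_iff.2 (by linarith)
      have := mul_pos hx (Real.exp_pos x)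
      linarith
  have h := pos_of_hasDerivAt_pos
    (f := fun x => x * Real.exp x - x + x ^ 2 - 2 * Real.exp x - 2 * Real.exp (-x) + 4)
    (f' := fun x => (x - 1) * Real.exp x - 1 + 2 * x + 2 * Real.exp (-x))
    (fun x => by
      have h := ((((((hasDerivAt_id' x).mul (Real.hasDerivAt_exp x)).sub (hasDerivAt_id' x)).add
        ((hasDerivAt_id' x).pow 2)).sub ((Real.hasDerivAt_exp x).const_mul 2)).sub
        ((hneg x).const_mul 2)).add_const 4
      refine h.congr_deriv ?_
      norm_num
      ring)
    (by norm_num) (fun x hx => hderiv hx) ht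
  have hE : Real.exp t * Real.exp (-t) = 1 := by rw [← Real.exp_add]; simp
  have h' := mul_pos (Real.exp_pos t) h
  linear_combination h' - 2 * hE

theorem strictAntiOn_mul_exp_sub_exp_add_one_div :
    StrictAntiOn (fun t : ℝ => (t * Real.exp t - Real.exp t + 1) / (t ^ 2 * (Real.exp t - 1)))
      (Set.Ioi 0) := by
  have hden {t : ℝ} (ht : 0 < t) : 0 < t ^ 2 * (Real.exp t - 1) :=
    mul_pos (by positivity) (by linarith [Real.add_one_lt_exp ht.ne'])
  have hd {t : ℝ} (ht : 0 < t) :=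
    ((((hasDerivAt_id' t).mul (Real.hasDerivAt_exp t)).sub (Real.hasDerivAt_exp t)).add_const
      1).div (((hasDerivAt_id' t).pow 2).mul ((Real.hasDerivAt_exp t).sub_const 1)) (hden ht).ne'
  refine strictAntiOn_of_deriv_neg (convex_Ioi 0)
    (fun t ht => (hd ht).continuousAt.continuousWithinAt) fun t ht => ?_
  rw [interior_Ioi] at ht
  refine (hd ht).deriv.trans_lt (div_neg_of_neg_of_pos ?_ (pow_pos (hden ht) 2))
  have h := mul_pos (Set.mem_Ioi.1 ht) (sub_pos.2 (two_mul_exp_sub_one_sq_lt ht))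
  simp only [Pi.mul_apply, Pi.sub_apply, Pi.pow_apply]
  norm_num
  linear_combination h

/-- For 0 < λ ≤ π/2, the function r ↦ λr e^{λr}(1 − r²) − (1 + r²)(e^{λr} − 1)
has exactly one root in (0,1). -/
theorem unique_root_C_lambda_e (lam : ℝ) (hlam₀ : 0 < lam) (hlam₁ : lam ≤ Real.pi / 2) :
    ∃! r : ℝ, r ∈ Set.Ioo (0:ℝ) 1 ∧
      lam*r*Real.exp (lam*r)*(1 - r^2) - (1 + r^2)*(Real.exp (lam*r) - 1) = 0 := by
  refine existsUnique_of_exists_of_unique ?_ ?_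
  · obtain ⟨a, ha, ha1, hpos⟩ : ∃ a : ℝ, 0 < a ∧ a < 1 ∧
        lam * a * Real.exp (lam * a) + Real.exp (lam * a) - 1 < lam ^ 2 / 2 := by
      have hc : Continuous fun a : ℝ =>
          lam * a * Real.exp (lam * a) + Real.exp (lam * a) - 1 := by fun_prop
      have hev := (hc.tendsto 0).eventually_lt_const
        (show _ < lam ^ 2 / 2 by simp; positivity)
      obtain ⟨a, h, ha⟩ := ((hev.filter_mono nhdsWithin_le_nhds).and
        (Ioo_mem_nhdsGT (zero_lt_one' ℝ))).exists
      exact ⟨a, ha.1, ha.2, h⟩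
    have hc : ContinuousOn (fun r : ℝ =>
        lam*r*Real.exp (lam*r)*(1 - r^2) - (1 + r^2)*(Real.exp (lam*r) - 1)) (Set.Icc a 1) := by
      fun_prop
    obtain ⟨r, hr, h⟩ := intermediate_value_Ioo' ha1.le hc (show (0 : ℝ) ∈ _ from ⟨by
      have := Real.add_one_lt_exp hlam₀.ne'
      norm_num
      linarith, by
      have h1 := sq_half_lt_mul_exp_sub_exp_add_one (mul_pos hlam₀ ha)
      have h2 := mul_lt_mul_of_pos_left hpos (pow_pos ha 2)
      linear_combination h1 + h2⟩)
    exact ⟨r, ⟨ha.trans hr.1, hr.2⟩, h⟩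
  · have key {r : ℝ} (hr : r ∈ Set.Ioo (0:ℝ) 1)
        (h : lam*r*Real.exp (lam*r)*(1 - r^2) - (1 + r^2)*(Real.exp (lam*r) - 1) = 0) :
        (lam * r * Real.exp (lam * r) - Real.exp (lam * r) + 1) /
          ((lam * r) ^ 2 * (Real.exp (lam * r) - 1)) = 2 / (lam ^ 2 * (1 - r ^ 2)) := by
      have ht := mul_pos hlam₀ hr.1
      have hE : 0 < Real.exp (lam * r) - 1 := by linarith [Real.add_one_lt_exp ht.ne']
      have h1 : 0 < 1 - r ^ 2 := by nlinarith [hr.1, hr.2]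
      rw [div_eq_div_iff (by positivity) (by positivity)]
      linear_combination lam ^ 2 * h
    have hlt {r s : ℝ} (hr : r ∈ Set.Ioo (0:ℝ) 1) (hs : s ∈ Set.Ioo (0:ℝ) 1)
        (h : lam*r*Real.exp (lam*r)*(1 - r^2) - (1 + r^2)*(Real.exp (lam*r) - 1) = 0)
        (h' : lam*s*Real.exp (lam*s)*(1 - s^2) - (1 + s^2)*(Real.exp (lam*s) - 1) = 0) :
        ¬ r < s := by
      intro hrs
      have hanti := strictAntiOn_mul_exp_sub_exp_add_one_div (mul_pos hlam₀ hr.1)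
        (mul_pos hlam₀ hs.1) (mul_lt_mul_of_pos_left hrs hlam₀)
      simp only [key hr h, key hs h'] at hanti
      have hs1 : 0 < 1 - s ^ 2 := by nlinarith [hs.1, hs.2]
      refine hanti.not_ge ?_
      have := hr.1
      gcongr
    rintro r s ⟨hr, h⟩ ⟨hs, h'⟩
    exact le_antisymm (not_lt.1 (hlt hs hr h' h)) (not_lt.1 (hlt hr hs h h'))
end
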